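/- Let P be the set of prime numbers, F a nonprincipal ultrafilter on P, and for each p ∈ P let 𝔽̄_p be an algebraic closure of the field 𝔽_p = ℤ/pℤ. Then there exists a ring isomorphism ulim_p 𝔽̄_p ≅ ℂ between the ultraproduct (∏_{p∈P} 𝔽̄_p)/I_F and the field of complex numbers. -/

import Mathlib

/-- The ideal of the product ring `Π i, K i` consisting of sequences vanishing on a set
belonging to the ultrafilter `F`. The quotient by this ideal is the ultraproduct. -/
def ultraIdeal {ι : Type*} (F : Ultrafilter ι) (K : ι → Type*) [∀ i, CommRing (K i)] :
    Ideal (Π i, K i) where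
  carrier := { f | { i | f i = 0 } ∈ F }
  zero_mem' := Filter.mem_of_superset Filter.univ_mem (fun i _ => rfl)
  add_mem' := by
    intro a b ha hb
    filter_upwards [ha, hb] with i h1 h2
    simp [h1, h2]
  smul_mem' := by
    intro c a ha
    filter_upwards [ha] with i h
    simp [h]


instance (p : Nat.Primes) : Fact (p : ℕ).Prime := ⟨p.2⟩

/-- `Fbar p` is an algebraic closure of the prime field `𝔽_p = ℤ/pℤ`. -/
abbrev Fbar (p : Nat.Primes) : Type := AlgebraicClosure (ZMod (p : ℕ))

open Cardinal

section Ultraproduct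

variable {ι : Type*} (F : Ultrafilter ι)

theorem mem_ultraIdeal {K : ι → Type*} [∀ i, CommRing (K i)] {f : Π i, K i} :
    f ∈ ultraIdeal F K ↔ { i | f i = 0 } ∈ F :=
  Iff.rfl

variable (K : ι → Type*) [∀ i, Field (K i)]

theorem ultraIdeal_isMaximal : (ultraIdeal F K).IsMaximal := by
  rw [Ideal.isMaximal_iff]
  refine ⟨fun h => ?_, fun J f hJ hf hfJ => ?_⟩
  · simp [mem_ultraIdeal] at h
  · have hne : { i | f i ≠ 0 } ∈ F := Ultrafilter.compl_mem_iff_notMem.mpr hf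
    have hmem : 1 - f⁻¹ * f ∈ ultraIdeal F K := by
      rw [mem_ultraIdeal]
      filter_upwards [hne] with i hi
      simp [inv_mul_cancel₀ (show f i ≠ 0 from hi)]
    simpa using J.add_mem (hJ hmem) (J.mul_mem_left f⁻¹ hfJ)

/-- The field structure on an ultraproduct of fields. -/
noncomputable abbrev ultraproductField : Field ((Π i, K i) ⧸ ultraIdeal F K) :=
  have := ultraIdeal_isMaximal F K
  Ideal.Quotient.field _

theorem ultraproduct_isAlgClosed [∀ i, IsAlgClosed (K i)] :
    @IsAlgClosed _ (ultraproductField F K) := by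
  let := ultraproductField F K
  refine IsAlgClosed.of_exists_root _ fun P hP hirr => ?_
  have hlift : P ∈ Polynomial.lifts (Ideal.Quotient.mk (ultraIdeal F K)) :=
    (Polynomial.mem_lifts P).mpr (Polynomial.map_surjective _ Ideal.Quotient.mk_surjective P)
  obtain ⟨Q, rfl, hdeg, hQ⟩ := Polynomial.lifts_and_natDegree_eq_and_monic hlift hP
  have hroot (i : ι) : ∃ x, (Q.map (Pi.evalRingHom K i)).IsRoot x := by
    refine IsAlgClosed.exists_root _ (Polynomial.natDegree_pos_iff_degree_pos.mp ?_).ne'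
    rw [hQ.natDegree_map, hdeg]
    exact hirr.natDegree_pos
  choose r hr using hroot
  refine ⟨Ideal.Quotient.mk _ r, ?_⟩
  have hQr : Q.eval r = 0 := by
    funext i
    have := hr i
    rwa [Polynomial.IsRoot, Polynomial.eval_map, ← Pi.evalRingHom_apply K i r,
      Polynomial.eval₂_at_apply] at this
  rw [Polynomial.eval_map, Polynomial.eval₂_at_apply, hQr, map_zero]

theorem continuum_le_mk_ultraproduct [∀ i, Infinite (K i)] (s : ι → ℕ)
    (hs : ∀ n, { i | n < s i } ∈ F) : 𝔠 ≤ #((Π i, K i) ⧸ ultraIdeal F K) := by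
  classical
  let code (A : Set ℕ) (n : ℕ) : Finset ℕ := {k ∈ Finset.range n | k ∈ A}
  let e (i : ι) : Finset ℕ ↪ K i :=
    (Encodable.encode' (Finset ℕ)).trans (Infinite.natEmbedding (K i))
  have hinj : Function.Injective fun A : Set ℕ =>
      Ideal.Quotient.mk (ultraIdeal F K) fun i => e i (code A (s i)) := by
    intro A B hAB
    rw [Ideal.Quotient.eq, mem_ultraIdeal] at hAB
    ext n
    obtain ⟨i, hi, hni⟩ := F.nonempty_of_mem (Filter.inter_mem hAB (hs n))
    have hcode : code A (s i) = code B (s i) := (e i).injective (sub_eq_zero.mp hi)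
    have hn : n < s i := hni
    simpa [code, hn] using Finset.ext_iff.mp hcode n
  simpa using lift_mk_le_lift_mk_of_injective hinj

end Ultraproduct

theorem mk_ultraproduct_le_continuum {ι : Type} [Countable ι] (F : Ultrafilter ι) (K : ι → Type)
    [∀ i, CommRing (K i)] [∀ i, Countable (K i)] :
    #((Π i, K i) ⧸ ultraIdeal F K) ≤ 𝔠 := by
  calc #((Π i, K i) ⧸ ultraIdeal F K) ≤ #(Π i, K i) :=
        mk_le_of_surjective Ideal.Quotient.mk_surjective
    _ ≤ #(ι → ℕ) := by
        choose f hf using fun i => exists_injective_nat (K i)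
        exact mk_le_of_injective (f := fun g i => f i (g i))
          fun g h hgh => funext fun i => hf i (congrFun hgh i)
    _ ≤ 𝔠 := by
        rw [← power_def, mk_nat, ← aleph0_power_aleph0]
        exact power_le_power_left aleph0_ne_zero mk_le_aleph0

instance (p : Nat.Primes) : Countable (Fbar p) :=
  mk_le_aleph0_iff.mp <|
    (Algebra.IsAlgebraic.cardinalMk_le_max (ZMod p) (Fbar p)).trans (by simp)

theorem setOf_lt_mem (F : Ultrafilter Nat.Primes)
    (hF : ∀ s : Set Nat.Primes, s.Finite → s ∉ F) (n : ℕ) :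
    { p : Nat.Primes | n < p } ∈ F := by
  rw [← Ultrafilter.compl_notMem_iff]
  have hfin : { p : Nat.Primes | (p : ℕ) ≤ n }.Finite :=
    (Set.finite_Iic n).preimage Nat.Primes.coe_nat_injective.injOn
  simpa only [Set.compl_ofPred, not_lt] using hF _ hfin

theorem ultraproduct_Fbar_charZero (F : Ultrafilter Nat.Primes)
    (hF : ∀ s : Set Nat.Primes, s.Finite → s ∉ F) :
    CharZero ((Π p, Fbar p) ⧸ ultraIdeal F Fbar) := by
  refine charZero_of_inj_zero fun n hn => ?_
  rw [← map_natCast (Ideal.Quotient.mk _), Ideal.Quotient.eq_zero_iff_mem, mem_ultraIdeal] at hn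
  obtain ⟨p, hp, hnp⟩ := F.nonempty_of_mem (Filter.inter_mem hn (setOf_lt_mem F hF n))
  have hdvd : (p : ℕ) ∣ n := (CharP.cast_eq_zero_iff (Fbar p) p n).mp hp
  exact Nat.eq_zero_of_dvd_of_lt hdvd hnp

/-- For a nonprincipal ultrafilter `F` on the set of primes, there is a ring isomorphism
between the ultraproduct `ulim_p 𝔽̄_p = (Π p, 𝔽̄_p) ⧸ I_F` and the complex numbers. -/
theorem ultraproduct_Fbar_iso_complex (F : Ultrafilter Nat.Primes)
    (hF : ∀ s : Set Nat.Primes, s.Finite → s ∉ F) :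
    Nonempty (((Π p, Fbar p) ⧸ ultraIdeal F Fbar) ≃+* ℂ) := by
  have hcard : #((Π p, Fbar p) ⧸ ultraIdeal F Fbar) = 𝔠 :=
    (mk_ultraproduct_le_continuum F Fbar).antisymm
      (continuum_le_mk_ultraproduct F Fbar (fun p => p) (setOf_lt_mem F hF))
  let := ultraproductField F Fbar
  have := ultraproduct_isAlgClosed F Fbar
  have := ultraproduct_Fbar_charZero F hF
  refine IsAlgClosed.ringEquiv_of_equiv_of_charZero ?_ ?_
  · rw [hcard]; exact aleph0_lt_continuum
  · exact Cardinal.eq.mp (hcard.trans mk_complex.symm)
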